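/- Fix an integer k ≥ 2, an integer ℓ ≥ k, a real p ∈ [1,∞), and constants C_F, c₁, c₂ > 0. There exists C > 0, depending only on k, ℓ, p, C_F, c₁, c₂, such that for every h ∈ (0,1], every map F : ℝ² → ℝ² with polynomial components of total degree ≤ k satisfying the isoparametric bounds of order k (with constants C_F, c₁, c₂ and parameter h), every v̂ : ℝ² → ℝ² with polynomial components of total degree ≤ k, and every i ∈ {1,2,3}, the Piola transform v of v̂ under F satisfies ‖v‖_{W^{ℓ,p}(F(K̂ᵢ))} ≤ C ‖v‖_{W^{k,p}(F(K̂ᵢ))}. -/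

import Mathlib

open Set MeasureTheory Function

noncomputable section

/-- The open reference triangle with vertices (0,0), (1,0), (0,1). -/
def Tref : Set (ℝ × ℝ) := {x | 0 < x.1 ∧ 0 < x.2 ∧ x.1 + x.2 < 1}

/-- The three vertices of the reference triangle. -/
def vtx : Fin 3 → ℝ × ℝ := ![(0, 0), (1, 0), (0, 1)]

/-- The (open) Clough–Tocher subtriangles, obtained by connecting the barycenter
to the vertices. -/
def ctK (i : Fin 3) : Set (ℝ × ℝ) :=
  interior (convexHull ℝ {vtx i, vtx (i + 1), ((1 : ℝ) / 3, (1 : ℝ) / 3)})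

/-- A map `ℝ² → ℝ²` whose two components are polynomials of total degree ≤ k. -/
def IsPolyMap (k : ℕ) (F : ℝ × ℝ → ℝ × ℝ) : Prop :=
  ∃ P Q : MvPolynomial (Fin 2) ℝ, P.totalDegree ≤ k ∧ Q.totalDegree ≤ k ∧
    ∀ x : ℝ × ℝ,
      F x = (MvPolynomial.eval ![x.1, x.2] P, MvPolynomial.eval ![x.1, x.2] Q)

/-- The Jacobian determinant of `F`. -/
def jacDet (F : ℝ × ℝ → ℝ × ℝ) (x : ℝ × ℝ) : ℝ :=
  LinearMap.det ((fderiv ℝ F x) : (ℝ × ℝ) →ₗ[ℝ] (ℝ × ℝ))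

/-- The Piola matrix `A(x) = DF(x) / det DF(x)`. -/
def Amap (F : ℝ × ℝ → ℝ × ℝ) (x : ℝ × ℝ) : (ℝ × ℝ) →L[ℝ] (ℝ × ℝ) :=
  (jacDet F x)⁻¹ • fderiv ℝ F x

/-- `B(x) = det DF(x) · (DF(x))⁻¹`, the adjugate of `DF`. -/
def Bmap (F : ℝ × ℝ → ℝ × ℝ) (x : ℝ × ℝ) : (ℝ × ℝ) →L[ℝ] (ℝ × ℝ) :=
  jacDet F x • Ring.inverse (fderiv ℝ F x)

/-- `v` is the Piola transform of `v̂` under `F`. -/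
def IsPiola (F vh v : ℝ × ℝ → ℝ × ℝ) : Prop :=
  ∀ x ∈ closure Tref, v (F x) = Amap F x (vh x)

/-- The `W^{m,p}` seminorm over a set `S` (for `p < ∞`). -/
def semiLp {E : Type*} [NormedAddCommGroup E] [NormedSpace ℝ E]
    (m : ℕ) (p : ℝ) (w : ℝ × ℝ → E) (S : Set (ℝ × ℝ)) : ℝ :=
  (∫ x in S, ‖iteratedFDeriv ℝ m w x‖ ^ p) ^ (1 / p)

/-- The `W^{m,p}` norm over a set `S`: the sum of the seminorms up to order `m`. -/
def normWmp {E : Type*} [NormedAddCommGroup E] [NormedSpace ℝ E]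
    (m : ℕ) (p : ℝ) (w : ℝ × ℝ → E) (S : Set (ℝ × ℝ)) : ℝ :=
  ∑ j ∈ Finset.range (m + 1), semiLp j p w S

/-- The isoparametric bounds of order `k` with constants `CF, c₁, c₂` and parameter `h`. -/
def IsoparamBounds (k : ℕ) (CF c₁ c₂ h : ℝ) (F : ℝ × ℝ → ℝ × ℝ) : Prop :=
  InjOn F (closure Tref) ∧
  (∀ m : ℕ, m ≤ k → ∀ x ∈ Tref, ‖iteratedFDeriv ℝ m F x‖ ≤ CF * h ^ m) ∧
  (∀ m : ℕ, m ≤ k + 1 → ∀ y ∈ F '' Tref,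
    ‖iteratedFDeriv ℝ m (invFunOn F (closure Tref)) y‖ ≤ CF * h ^ (-(m : ℤ))) ∧
  (∀ x ∈ closure Tref, c₁ * h ^ 2 ≤ jacDet F x ∧ jacDet F x ≤ c₂ * h ^ 2)

/-- The (planar) divergence of a vector field. -/
def pdiv (w : ℝ × ℝ → ℝ × ℝ) (x : ℝ × ℝ) : ℝ :=
  (fderiv ℝ w x (1, 0)).1 + (fderiv ℝ w x (0, 1)).2

open scoped ContDiff Nat Topology

section Jets

variable {E F G : Type*} [NormedAddCommGroup E] [NormedSpace ℝ E]
  [NormedAddCommGroup F] [NormedSpace ℝ F] [NormedAddCommGroup G] [NormedSpace ℝ G]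

lemma exists_open_contDiffOn {f : E → F} {x : E} {n : ℕ} (hf : ContDiffAt ℝ n f x) :
    ∃ s : Set E, IsOpen s ∧ x ∈ s ∧ ContDiffOn ℝ n f s := by
  have h := hf.eventually (by simp)
  obtain ⟨s, hs, ho, hx⟩ := eventually_nhds_iff.1 h
  exact ⟨s, ho, hx, fun y hy => (hs y hy).contDiffWithinAt⟩

lemma comp_at {g : F → G} {f : E → F} {x : E} {n : ℕ} (hg : ContDiffAt ℝ n g (f x))
    (hf : ContDiffAt ℝ n f x) {C D : ℝ}
    (hC : ∀ i, i ≤ n → ‖iteratedFDeriv ℝ i g (f x)‖ ≤ C)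
    (hD : ∀ i, 1 ≤ i → i ≤ n → ‖iteratedFDeriv ℝ i f x‖ ≤ D ^ i) :
    ‖iteratedFDeriv ℝ n (g ∘ f) x‖ ≤ n ! * C * D ^ n := by
  obtain ⟨t, hto, hxt, ht⟩ := exists_open_contDiffOn hg
  obtain ⟨s, hso, hxs, hs⟩ := exists_open_contDiffOn hf
  have ho : IsOpen (s ∩ f ⁻¹' t) := hs.continuousOn.isOpen_inter_preimage hso hto
  have hx : x ∈ s ∩ f ⁻¹' t := ⟨hxs, hxt⟩
  rw [← iteratedFDerivWithin_of_isOpen n ho hx]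
  refine norm_iteratedFDerivWithin_comp_le ht (hs.mono inter_subset_left) le_rfl
    hto.uniqueDiffOn ho.uniqueDiffOn (fun y hy => hy.2) hx ?_ ?_
  · intro i hi
    rw [iteratedFDerivWithin_of_isOpen i hto hxt]
    exact hC i hi
  · intro i h1 hi
    rw [iteratedFDerivWithin_of_isOpen i ho hx]
    exact hD i h1 hi

/-- jets up to order `n` bounded by `K`. -/
def JB (n : ℕ) (K : ℝ) (f : E → F) (x : E) : Prop :=
  ∀ i, i ≤ n → ‖iteratedFDeriv ℝ i f x‖ ≤ K

lemma JB.mono {n m : ℕ} {K L : ℝ} {f : E → F} {x : E} (h : JB n K f x) (hm : m ≤ n)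
    (hK : K ≤ L) : JB m L f x := fun i hi => (h i (hi.trans hm)).trans hK

lemma JB.congr {n : ℕ} {K : ℝ} {f g : E → F} {x : E} (h : JB n K f x) (hfg : f =ᶠ[𝓝 x] g) :
    JB n K g x := by
  intro i hi
  rw [← (hfg.iteratedFDeriv ℝ i).eq_of_nhds]
  exact h i hi

lemma JB.nonneg {n : ℕ} {K : ℝ} {f : E → F} {x : E} (h : JB n K f x) : 0 ≤ K :=
  (norm_nonneg _).trans (h 0 (Nat.zero_le _))

lemma JB.comp' {g : F → G} {f : E → F} {x : E} {n : ℕ} (hg : ContDiffAt ℝ n g (f x))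
    (hf : ContDiffAt ℝ n f x) {C D : ℝ} (hC : JB n C g (f x)) (hD1 : 1 ≤ D)
    (hD : ∀ i, 1 ≤ i → i ≤ n → ‖iteratedFDeriv ℝ i f x‖ ≤ D) :
    JB n (n ! * D ^ n * C) (g ∘ f) x := by
  intro i hi
  have hi' : (i : ℕ∞ω) ≤ n := by exact_mod_cast hi
  refine (comp_at (hg.of_le hi') (hf.of_le hi') (fun j hj => hC j (hj.trans hi)) (D := D)
    (fun j h1 hj => (hD j h1 (hj.trans hi)).trans (le_self_pow₀ hD1 (by omega)))).trans ?_
  have := hC.nonneg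
  have h1 : (i ! : ℝ) ≤ n ! := by exact_mod_cast Nat.factorial_le hi
  calc (i ! : ℝ) * C * D ^ i = i ! * D ^ i * C := by ring
    _ ≤ n ! * D ^ n * C := by gcongr

lemma JB.clm {f : E → F →L[ℝ] G} {g : E → F} {x : E} {n : ℕ} (hf : ContDiffAt ℝ n f x)
    (hg : ContDiffAt ℝ n g x) {a b : ℝ} (ha : JB n a f x) (hb : JB n b g x) :
    JB n (2 ^ n * a * b) (fun y => f y (g y)) x := by
  intro i hi
  have hi' : (i : ℕ∞ω) ≤ n := by exact_mod_cast hi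
  obtain ⟨t, hto, hxt, ht⟩ := exists_open_contDiffOn hg
  obtain ⟨s, hso, hxs, hs⟩ := exists_open_contDiffOn hf
  have ho : IsOpen (s ∩ t) := hso.inter hto
  have hx : x ∈ s ∩ t := ⟨hxs, hxt⟩
  have key := norm_iteratedFDerivWithin_clm_apply (hs.mono inter_subset_left)
    (ht.mono inter_subset_right) ho.uniqueDiffOn hx hi'
  rw [iteratedFDerivWithin_of_isOpen i ho hx] at key
  refine key.trans ?_
  have h0 := ha.nonneg
  have h0' := hb.nonneg
  calc _ ≤ ∑ j ∈ Finset.range (i + 1), (i.choose j : ℝ) * a * b := by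
        refine Finset.sum_le_sum fun j hj => ?_
        have hj' : j ≤ i := Nat.lt_succ_iff.1 (Finset.mem_range.1 hj)
        rw [iteratedFDerivWithin_of_isOpen j ho hx, iteratedFDerivWithin_of_isOpen (i - j) ho hx]
        have h1 := ha j (hj'.trans hi)
        have h2 := hb (i - j) ((Nat.sub_le _ _).trans hi)
        gcongr
    _ = 2 ^ i * a * b := by
        rw [← Finset.sum_mul, ← Finset.sum_mul]
        congr 2
        exact_mod_cast Nat.sum_range_choose i
    _ ≤ 2 ^ n * a * b := by gcongr; norm_num

lemma JB_of_compact {ph : E → F} {K : Set E} (hK : IsCompact K)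
    (hph : ∀ x ∈ K, ContDiffAt ℝ ω ph x) (n : ℕ) :
    ∃ C : ℝ, 1 ≤ C ∧ ∀ x ∈ K, JB n C ph x := by
  have h1 : ∀ i : ℕ, ∃ C : ℝ, ∀ x ∈ K, ‖iteratedFDeriv ℝ i ph x‖ ≤ C := by
    intro i
    apply hK.exists_bound_of_continuousOn
    intro x hx
    exact ((hph x hx).continuousAt_iteratedFDeriv le_top).continuousWithinAt
  choose C hC using h1
  refine ⟨1 + ∑ i ∈ Finset.range (n + 1), |C i|, ?_, ?_⟩
  · have : 0 ≤ ∑ i ∈ Finset.range (n + 1), |C i| := Finset.sum_nonneg fun _ _ => abs_nonneg _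
    linarith
  · intro x hx i hi
    have h2 : |C i| ≤ ∑ i ∈ Finset.range (n + 1), |C i| :=
      Finset.single_le_sum (f := fun i => |C i|) (fun _ _ => abs_nonneg _)
        (Finset.mem_range.2 (Nat.lt_succ_of_le hi))
    have h3 := hC i x hx
    have h4 := le_abs_self (C i)
    linarith

end Jets

abbrev V := ℝ × ℝ

lemma det_formula (L : V →L[ℝ] V) : LinearMap.det (L : V →ₗ[ℝ] V) =
    (L (1, 0)).1 * (L (0, 1)).2 - (L (0, 1)).1 * (L (1, 0)).2 := by
  rw [← LinearMap.det_toMatrix (Module.Basis.finTwoProd ℝ), Matrix.det_fin_two]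
  simp [LinearMap.toMatrix_apply]

def dt (L : V →L[ℝ] V) : ℝ := LinearMap.det (L : V →ₗ[ℝ] V)

lemma dt_contDiff : ContDiff ℝ ω dt := by
  have : dt = fun L : V →L[ℝ] V =>
    (L (1, 0)).1 * (L (0, 1)).2 - (L (0, 1)).1 * (L (1, 0)).2 := funext det_formula
  rw [this]
  fun_prop

lemma isUnit_of_dt {L : V →L[ℝ] V} (h : dt L ≠ 0) : IsUnit L := by
  have h1 : IsUnit (LinearMap.det (L : V →ₗ[ℝ] V)) := isUnit_iff_ne_zero.2 h
  let e := LinearMap.equivOfDetNeZero (L : V →ₗ[ℝ] V) h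
  have he : ((e.toContinuousLinearEquiv : V ≃L[ℝ] V) : V →L[ℝ] V) = L := by
    ext <;> rfl
  rw [← he]
  exact ⟨(ContinuousLinearEquiv.unitsEquiv ℝ V).symm e.toContinuousLinearEquiv, rfl⟩

def phiA (L : V →L[ℝ] V) : V →L[ℝ] V := (dt L)⁻¹ • L
def phiI (L : V →L[ℝ] V) : V →L[ℝ] V := Ring.inverse L
def phiB (L : V →L[ℝ] V) : V →L[ℝ] V := dt L • Ring.inverse L

lemma phiA_cd {L : V →L[ℝ] V} (h : dt L ≠ 0) : ContDiffAt ℝ ω phiA L :=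
  (dt_contDiff.contDiffAt.inv h).smul contDiffAt_id

lemma phiI_cd {L : V →L[ℝ] V} (h : dt L ≠ 0) : ContDiffAt ℝ ω phiI L := by
  obtain ⟨u, rfl⟩ := isUnit_of_dt h
  exact contDiffAt_ringInverse ℝ u

lemma phiB_cd {L : V →L[ℝ] V} (h : dt L ≠ 0) : ContDiffAt ℝ ω phiB L :=
  dt_contDiff.contDiffAt.smul (phiI_cd h)

lemma phiB_phiA {L : V →L[ℝ] V} (h : dt L ≠ 0) (x : V) : phiB L (phiA L x) = x := by
  have h1 : (Ring.inverse L) (L x) = x := by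
    have := Ring.inverse_mul_cancel L (isUnit_of_dt h)
    exact congrArg (fun T : V →L[ℝ] V => T x) this
  simp [phiB, phiA, h1, smul_smul, h]

def KK (M c : ℝ) : Set (V →L[ℝ] V) := {L | ‖L‖ ≤ M ∧ c ≤ dt L}

lemma KK_compact (M c : ℝ) : IsCompact (KK M c) := by
  have : KK M c = Metric.closedBall 0 M ∩ {L | c ≤ dt L} := by
    ext L; simp [KK]
  rw [this]
  exact (isCompact_closedBall _ _).inter_right
    (isClosed_le continuous_const dt_contDiff.continuous)

lemma KK_bounds {M c : ℝ} (hc : 0 < c) (n : ℕ) : ∃ C : ℝ, 1 ≤ C ∧ ∀ L ∈ KK M c,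
    JB n C phiA L ∧ JB n C phiB L ∧ JB n C phiI L := by
  have hne : ∀ L ∈ KK M c, dt L ≠ 0 := fun L hL => (hc.trans_le hL.2).ne'
  obtain ⟨a, ha, ha'⟩ := JB_of_compact (KK_compact M c) (fun L hL => phiA_cd (hne L hL)) n
  obtain ⟨b, hb, hb'⟩ := JB_of_compact (KK_compact M c) (fun L hL => phiB_cd (hne L hL)) n
  obtain ⟨d, hd, hd'⟩ := JB_of_compact (KK_compact M c) (fun L hL => phiI_cd (hne L hL)) n
  exact ⟨a + b + d, by linarith, fun L hL => ⟨(ha' L hL).mono le_rfl (by linarith),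
    (hb' L hL).mono le_rfl (by linarith), (hd' L hL).mono le_rfl (by linarith)⟩⟩

lemma fderiv_JB {G : V → V} {z : V} {M : ℝ} (hM : ∀ i, 1 ≤ i → ‖iteratedFDeriv ℝ i G z‖ ≤ M)
    (n : ℕ) : JB n M (fderiv ℝ G) z := by
  intro i _
  rw [norm_iteratedFDeriv_fderiv]
  exact hM (i + 1) (by omega)

lemma mem_KK {G : V → V} {z : V} {M c : ℝ} (hM : ∀ i, 1 ≤ i → ‖iteratedFDeriv ℝ i G z‖ ≤ M)
    (hc : c ≤ dt (fderiv ℝ G z)) : fderiv ℝ G z ∈ KK M c := by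
  refine ⟨?_, hc⟩
  have := hM 1 le_rfl
  rwa [norm_iteratedFDeriv_one] at this

lemma fderiv_cd {G : V → V} (hG : ContDiff ℝ ω G) : ContDiff ℝ ω (fderiv ℝ G) :=
  hG.fderiv_right (by simp)

/-- Bounds for the jets of `phiA, phiB, phiI` composed with `DG`. -/
lemma phi_bounds (M c : ℝ) (hM1 : 1 ≤ M) (hc : 0 < c) (n : ℕ) : ∃ C : ℝ, 1 ≤ C ∧
    ∀ (G : V → V) (z : V), ContDiff ℝ ω G → (∀ i, 1 ≤ i → ‖iteratedFDeriv ℝ i G z‖ ≤ M) →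
    c ≤ dt (fderiv ℝ G z) →
    JB n C (phiA ∘ fderiv ℝ G) z ∧ JB n C (phiB ∘ fderiv ℝ G) z ∧
      JB n C (phiI ∘ fderiv ℝ G) z := by
  obtain ⟨C, hC1, hC⟩ := KK_bounds (M := M) hc n
  refine ⟨n ! * M ^ n * C, ?_, ?_⟩
  · have h1 : (1 : ℝ) ≤ n ! := by exact_mod_cast Nat.one_le_iff_ne_zero.2 (Nat.factorial_ne_zero n)
    have h2 : (1 : ℝ) ≤ M ^ n := one_le_pow₀ hM1
    exact one_le_mul_of_one_le_of_one_le (one_le_mul_of_one_le_of_one_le h1 h2) hC1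
  · intro G z hG hM hd
    have hne : dt (fderiv ℝ G z) ≠ 0 := (hc.trans_le hd).ne'
    have hf : ContDiffAt ℝ n (fderiv ℝ G) z := (fderiv_cd hG).contDiffAt.of_le le_top
    obtain ⟨h1, h2, h3⟩ := hC _ (mem_KK hM hd)
    have hD : ∀ i, 1 ≤ i → i ≤ n → ‖iteratedFDeriv ℝ i (fderiv ℝ G) z‖ ≤ M :=
      fun i _ hi => fderiv_JB hM n i hi
    exact ⟨JB.comp' ((phiA_cd hne).of_le le_top) hf h1 hM1 hD,
      JB.comp' ((phiB_cd hne).of_le le_top) hf h2 hM1 hD,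
      JB.comp' ((phiI_cd hne).of_le le_top) hf h3 hM1 hD⟩

lemma dt_ev {G : V → V} {z : V} (hG : ContDiff ℝ ω G) (hne : dt (fderiv ℝ G z) ≠ 0) :
    ∀ᶠ z' in 𝓝 z, dt (fderiv ℝ G z') ≠ 0 :=
  ((dt_contDiff.continuous.comp (fderiv_cd hG).continuous).continuousAt).eventually_ne hne

lemma fderiv_locInv {G : V → V} {z : V} (hG : ContDiff ℝ ω G) (hne : dt (fderiv ℝ G z) ≠ 0)
    {g : V → V} (hg : ContDiffAt ℝ ω g (G z)) (hgz : g (G z) = z)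
    (hr : ∀ᶠ y in 𝓝 (G z), G (g y) = y) :
    fderiv ℝ g =ᶠ[𝓝 (G z)] (phiI ∘ fderiv ℝ G) ∘ g := by
  have e1 : ∀ᶠ y in 𝓝 (G z), dt (fderiv ℝ G (g y)) ≠ 0 := by
    apply hg.continuousAt.eventually (p := fun w => dt (fderiv ℝ G w) ≠ 0)
    rw [hgz]
    exact dt_ev hG hne
  have e2 : ∀ᶠ y in 𝓝 (G z), ContDiffAt ℝ ω g y := hg.eventually (by simp)
  filter_upwards [e1, e2, hr.eventually_nhds] with y h1 h2 h3
  have hd : DifferentiableAt ℝ g y := h2.differentiableAt (by simp)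
  have h4 : HasFDerivAt (G ∘ g) ((fderiv ℝ G (g y)).comp (fderiv ℝ g y)) y :=
    ((hG.differentiable (by simp)).differentiableAt.hasFDerivAt).comp y hd.hasFDerivAt
  have h5 : HasFDerivAt (G ∘ g) (ContinuousLinearMap.id ℝ V) y :=
    (hasFDerivAt_id y).congr_of_eventuallyEq h3
  have h6 : fderiv ℝ G (g y) * fderiv ℝ g y = 1 := h4.unique h5
  have h7 := Ring.inverse_mul_cancel _ (isUnit_of_dt h1)
  change fderiv ℝ g y = Ring.inverse (fderiv ℝ G (g y))
  calc fderiv ℝ g y = (Ring.inverse (fderiv ℝ G (g y)) * fderiv ℝ G (g y)) * fderiv ℝ g y := by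
        rw [h7, one_mul]
    _ = _ := by rw [mul_assoc, h6, mul_one]

lemma inv_bounds (M c : ℝ) (hM1 : 1 ≤ M) (hc : 0 < c) (m : ℕ) : ∃ C : ℝ, 1 ≤ C ∧
    ∀ (G : V → V) (z : V), ContDiff ℝ ω G → (∀ i, 1 ≤ i → ‖iteratedFDeriv ℝ i G z‖ ≤ M) →
    c ≤ dt (fderiv ℝ G z) → ∀ g : V → V, ContDiffAt ℝ ω g (G z) → g (G z) = z →
    (∀ᶠ y in 𝓝 (G z), G (g y) = y) →
    ∀ i, 1 ≤ i → i ≤ m → ‖iteratedFDeriv ℝ i g (G z)‖ ≤ C := by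
  induction m with
  | zero =>
    refine ⟨1, le_rfl, ?_⟩
    intros
    omega
  | succ m ih =>
    obtain ⟨Cg, hCg1, hCg⟩ := ih
    obtain ⟨C, hC1, hC⟩ := phi_bounds M c hM1 hc m
    refine ⟨max 1 (m ! * Cg ^ m * C), le_max_left _ _, ?_⟩
    intro G z hG hM hd g hg hgz hr i hi1 him
    have hne : dt (fderiv ℝ G z) ≠ 0 := (hc.trans_le hd).ne'
    obtain ⟨j, rfl⟩ : ∃ j, i = j + 1 := ⟨i - 1, by omega⟩
    rw [← norm_iteratedFDeriv_fderiv]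
    refine le_trans ?_ (le_max_right _ _)
    have hpc : ContDiffAt ℝ ω (phiI ∘ fderiv ℝ G) z :=
      ContDiffAt.comp z (phiI_cd hne) (fderiv_cd hG).contDiffAt
    have hJ := (hC G z hG hM hd).2.2
    rw [← hgz] at hJ hpc
    exact (JB.comp' (hpc.of_le le_top) (hg.of_le le_top) hJ hCg1
      (hCg G z hG hM hd g hg hgz hr)).congr (fderiv_locInv hG hne hg hgz hr).symm j (by omega)

lemma exists_inv {G : V → V} {z : V} (hG : ContDiff ℝ ω G) (hne : dt (fderiv ℝ G z) ≠ 0) :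
    𝓝 (G z) ≤ Filter.map G (𝓝 z) ∧
    ∃ g : V → V, ContDiffAt ℝ ω g (G z) ∧ g (G z) = z ∧ ∀ᶠ y in 𝓝 (G z), G (g y) = y := by
  obtain ⟨u, hu⟩ := isUnit_of_dt hne
  let e : V ≃L[ℝ] V := ContinuousLinearEquiv.unitsEquiv ℝ V u
  have he : HasFDerivAt G (e : V →L[ℝ] V) z := by
    have h1 : (e : V →L[ℝ] V) = fderiv ℝ G z := by rw [← hu]; rfl
    rw [h1]
    exact (hG.differentiable (by simp)).differentiableAt.hasFDerivAt
  have hs : HasStrictFDerivAt G (e : V →L[ℝ] V) z :=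
    hG.contDiffAt.hasStrictFDerivAt' he (by simp)
  exact ⟨hs.map_nhds_eq_of_equiv.ge, hG.contDiffAt.localInverse he (n := ω) (by simp),
    hG.contDiffAt.to_localInverse he (by simp),
    hG.contDiffAt.localInverse_apply_image he (by simp), hs.eventually_right_inverse⟩

lemma germ (M c : ℝ) (hM1 : 1 ≤ M) (hc : 0 < c) (n : ℕ) : ∃ C : ℝ, 1 ≤ C ∧
    ∀ (G : V → V) (z : V), ContDiff ℝ ω G → (∀ i, 1 ≤ i → ‖iteratedFDeriv ℝ i G z‖ ≤ M) →
    c ≤ dt (fderiv ℝ G z) → ∀ vt : V → V, ContDiff ℝ ω vt → ∀ v : V → V,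
    (∀ᶠ z' in 𝓝 z, v (G z') = phiA (fderiv ℝ G z') (vt z')) →
    ContDiffAt ℝ ω v (G z) ∧ (∀ N, JB n N v (G z) → JB n (C * N) vt z) ∧
      (∀ N, JB n N vt z → JB n (C * N) v (G z)) := by
  obtain ⟨Cp, hCp1, hCp⟩ := phi_bounds M c hM1 hc n
  obtain ⟨Cg, hCg1, hCg⟩ := inv_bounds M c hM1 hc n
  refine ⟨max 1 (max (2 ^ n * Cp * (n ! * M ^ n)) (n ! * Cg ^ n * (2 ^ n * Cp))),
    le_max_left _ _, ?_⟩
  intro G z hG hM hd vt hvt v hv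
  have hne : dt (fderiv ℝ G z) ≠ 0 := (hc.trans_le hd).ne'
  obtain ⟨-, g, hg, hgz, hr⟩ := exists_inv hG hne
  obtain ⟨hA, hB, -⟩ := hCp G z hG hM hd
  have hAc : ContDiffAt ℝ ω (phiA ∘ fderiv ℝ G) z :=
    ContDiffAt.comp z (phiA_cd hne) (fderiv_cd hG).contDiffAt
  have hBc : ContDiffAt ℝ ω (phiB ∘ fderiv ℝ G) z :=
    ContDiffAt.comp z (phiB_cd hne) (fderiv_cd hG).contDiffAt
  have hw : ContDiffAt ℝ ω (fun z' => (phiA ∘ fderiv ℝ G) z' (vt z')) z :=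
    hAc.clm_apply hvt.contDiffAt
  have hev : (fun z' => (phiA ∘ fderiv ℝ G) z' (vt z')) ∘ g =ᶠ[𝓝 (G z)] v := by
    have h1 : ∀ᶠ y in 𝓝 (G z), v (G (g y)) = phiA (fderiv ℝ G (g y)) (vt (g y)) := by
      apply hg.continuousAt.eventually (p := fun z' => v (G z') = phiA (fderiv ℝ G z') (vt z'))
      rw [hgz]; exact hv
    filter_upwards [h1, hr] with y h2 h3
    rw [h3] at h2
    exact h2.symm
  have hw' := hw
  rw [← hgz] at hw'
  have hvc : ContDiffAt ℝ ω v (G z) := (ContDiffAt.comp (G z) hw' hg).congr_of_eventuallyEq hev.symm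
  refine ⟨hvc, ?_, ?_⟩
  · intro N hN
    have h0 := hN.nonneg
    have h1 : JB n (n ! * M ^ n * N) (v ∘ G) z :=
      JB.comp' (hvc.of_le le_top) (hG.contDiffAt.of_le le_top) hN hM1 (fun i h _ => hM i h)
    have h2 := JB.clm (hBc.of_le le_top) ((hvc.comp z hG.contDiffAt).of_le le_top) hB h1
    have h3 : (fun y => (phiB ∘ fderiv ℝ G) y ((v ∘ G) y)) =ᶠ[𝓝 z] vt := by
      filter_upwards [hv, dt_ev hG hne] with y h4 h5
      change phiB (fderiv ℝ G y) (v (G y)) = vt y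
      rw [h4, phiB_phiA h5]
    refine (h2.congr h3).mono le_rfl ?_
    rw [← mul_assoc]
    gcongr
    exact (le_max_left _ _).trans (le_max_right _ _)
  · intro N hN
    have h0 := hN.nonneg
    have h1 := JB.clm (hAc.of_le le_top) (hvt.contDiffAt.of_le le_top) hA hN
    rw [← hgz] at h1
    have h2 := JB.comp' (hw'.of_le le_top) (hg.of_le le_top) h1 hCg1
      (hCg G z hG hM hd g hg hgz hr)
    refine (h2.congr hev).mono le_rfl ?_
    rw [← mul_assoc]
    gcongr
    exact (le_max_right _ _).trans (le_max_right _ _)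

/-- Smooth functions all of whose derivatives of order `> d` vanish. -/
def PD (d : ℕ) (f : V → ℝ) : Prop :=
  ContDiff ℝ ω f ∧ ∀ i, d < i → ∀ x, iteratedFDeriv ℝ i f x = 0

lemma PD.mono {d e : ℕ} {f : V → ℝ} (h : PD d f) (hd : d ≤ e) : PD e f :=
  ⟨h.1, fun i hi => h.2 i (hd.trans_lt hi)⟩

lemma PD_const (a : ℝ) : PD 0 (fun _ => a) :=
  ⟨contDiff_const, fun i hi x => by rw [iteratedFDeriv_const_of_ne (by omega)]; rfl⟩

lemma PD_clm (L : V →L[ℝ] ℝ) : PD 1 (fun x => L x) := by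
  refine ⟨L.contDiff, fun i hi x => ?_⟩
  obtain ⟨j, rfl⟩ : ∃ j, i = j + 1 := ⟨i - 1, by omega⟩
  rw [← norm_eq_zero, ← norm_iteratedFDeriv_fderiv]
  have : fderiv ℝ (fun x => L x) = fun _ => L := by
    ext x : 1
    exact L.fderiv
  rw [this, iteratedFDeriv_const_of_ne (by omega)]
  simp

lemma PD.mul {d e : ℕ} {f g : V → ℝ} (hf : PD d f) (hg : PD e g) :
    PD (d + e) (fun x => f x * g x) := by
  refine ⟨hf.1.mul hg.1, fun i hi x => ?_⟩
  have h := norm_iteratedFDeriv_mul_le hf.1 hg.1 x (n := i) le_top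
  rw [← norm_le_zero_iff]
  refine h.trans (le_of_eq ?_)
  refine Finset.sum_eq_zero fun j _ => ?_
  by_cases hj : d < j
  · simp [hf.2 j hj x]
  · simp [hg.2 (i - j) (by omega) x]

lemma PD.pow {d : ℕ} {f : V → ℝ} (hf : PD d f) (n : ℕ) : PD (n * d) (fun x => f x ^ n) := by
  induction n with
  | zero => simpa using PD_const 1
  | succ n ih =>
    simp only [pow_succ]
    exact (ih.mul hf).mono (by rw [Nat.succ_mul])

lemma PD_sum {ι : Type*} {d : ℕ} (s : Finset ι) (f : ι → V → ℝ) (h : ∀ i ∈ s, PD d (f i)) :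
    PD d (fun x => ∑ i ∈ s, f i x) := by
  refine ⟨ContDiff.sum fun i hi => (h i hi).1, fun j hj x => ?_⟩
  have := iteratedFDeriv_sum_apply (𝕜 := ℝ) (n := j) (x := x) (f := f) (u := s)
    (fun i hi => (h i hi).1.contDiffAt.of_le le_top)
  rw [show (fun x => ∑ i ∈ s, f i x) = ∑ i ∈ s, f i by ext; simp, this]
  exact Finset.sum_eq_zero fun i hi => (h i hi).2 j hj x

lemma PD_poly {k : ℕ} (P : MvPolynomial (Fin 2) ℝ) (hP : P.totalDegree ≤ k) :
    PD k (fun x : V => MvPolynomial.eval ![x.1, x.2] P) := by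
  simp only [MvPolynomial.eval_eq']
  refine PD_sum _ _ fun d hd => ?_
  simp only [Fin.prod_univ_two, Matrix.cons_val_zero, Matrix.cons_val_one]
  have h1 := ((PD_clm (ContinuousLinearMap.fst ℝ ℝ ℝ)).pow (d 0)).mul
    ((PD_clm (ContinuousLinearMap.snd ℝ ℝ ℝ)).pow (d 1))
  refine ((PD_const (P.coeff d)).mul h1).mono ?_
  have h2 := MvPolynomial.le_totalDegree hd
  rw [Finsupp.sum_fintype _ _ (by simp), Fin.sum_univ_two] at h2
  omega

lemma poly_facts {k : ℕ} {F : V → V} (h : IsPolyMap k F) :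
    ContDiff ℝ ω F ∧ ∀ i, k < i → ∀ x, iteratedFDeriv ℝ i F x = 0 := by
  obtain ⟨P, Q, hP, hQ, hF⟩ := h
  have h1 := PD_poly P hP
  have h2 := PD_poly Q hQ
  have hF' : F = fun x : V => ((fun x : V => MvPolynomial.eval ![x.1, x.2] P) x,
    (fun x : V => MvPolynomial.eval ![x.1, x.2] Q) x) := funext hF
  rw [hF']
  refine ⟨h1.1.prodMk h2.1, fun i hi x => ?_⟩
  rw [iteratedFDeriv_prodMk (n := ω) h1.1.contDiffAt h2.1.contDiffAt le_top,
    h1.2 i hi, h2.2 i hi]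
  rfl

lemma dt_smul (a : ℝ) (L : V →L[ℝ] V) : dt (a • L) = a ^ 2 * dt L := by
  simp only [dt, det_formula]
  simp
  ring

lemma Tref_open : IsOpen Tref := by
  have : Tref = {x | 0 < x.1} ∩ ({x | 0 < x.2} ∩ {x | x.1 + x.2 < 1}) := by
    ext x; simp [Tref]
  rw [this]
  exact (isOpen_lt (by fun_prop) (by fun_prop)).inter
    ((isOpen_lt (by fun_prop) (by fun_prop)).inter (isOpen_lt (by fun_prop) (by fun_prop)))

lemma ctK_sub (i : Fin 3) : ctK i ⊆ Tref := by
  have hsub : convexHull ℝ {vtx i, vtx (i + 1), ((1 : ℝ) / 3, (1 : ℝ) / 3)} ⊆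
      {x : V | 0 ≤ x.1 ∧ 0 ≤ x.2 ∧ x.1 + x.2 ≤ 1} := by
    apply convexHull_min
    · intro x hx
      simp only [Set.mem_insert_iff, Set.mem_singleton_iff] at hx
      rcases hx with rfl | rfl | rfl
      · fin_cases i <;> simp [vtx]
      · fin_cases i <;> simp [vtx]
      · norm_num
    · intro x hx y hy a b ha hb hab
      obtain ⟨h1, h2, h3⟩ := hx
      obtain ⟨h4, h5, h6⟩ := hy
      simp only [Set.mem_ofPred_eq, Prod.fst_add, Prod.snd_add, Prod.smul_fst, Prod.smul_snd,
        smul_eq_mul]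
      refine ⟨by positivity, by positivity, ?_⟩
      nlinarith
  intro x hx
  have hx' : x ∈ interior {x : V | 0 ≤ x.1 ∧ 0 ≤ x.2 ∧ x.1 + x.2 ≤ 1} := interior_mono hsub hx
  obtain ⟨e, he, hb⟩ := Metric.isOpen_iff.1 isOpen_interior x hx'
  have hmem : ∀ t : ℝ, |t| < e → (x.1 + t, x.2 + t) ∈
      {x : V | 0 ≤ x.1 ∧ 0 ≤ x.2 ∧ x.1 + x.2 ≤ 1} := by
    intro t ht
    apply interior_subset
    apply hb
    rw [Metric.mem_ball, Prod.dist_eq]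
    simp [Real.dist_eq, ht]
  have h1 := hmem (e / 2) (by rw [abs_of_pos] <;> linarith)
  have h2 := hmem (-(e / 2)) (by rw [abs_neg, abs_of_pos] <;> linarith)
  simp only [Set.mem_ofPred_eq] at h1 h2
  exact ⟨by linarith [h2.1], by linarith [h2.2.1], by linarith [h1.2.2]⟩

lemma scaled_fderiv {F : V → V} (hF : ContDiff ℝ ω F) (a : ℝ) (z : V) :
    fderiv ℝ (fun z => F (a • z)) z = a • fderiv ℝ F (a • z) := by
  rw [fderiv_comp_smul]

lemma point (k ℓ : ℕ) (hℓ : k ≤ ℓ) (CF c₁ : ℝ) (hc₁ : 0 < c₁) :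
    ∃ C : ℝ, 0 < C ∧ ∀ (c₂ h : ℝ), h ∈ Set.Ioc (0 : ℝ) 1 → ∀ F : V → V,
      IsPolyMap k F → IsoparamBounds k CF c₁ c₂ h F →
      ∀ vhat : V → V, IsPolyMap k vhat → ∀ v : V → V, IsPiola F vhat v →
      ∃ B : ℝ, ∀ x ∈ Tref, 𝓝 (F x) ≤ Filter.map F (𝓝 x) ∧ ContDiffAt ℝ ω v (F x) ∧
        JB ℓ B v (F x) ∧
        JB ℓ (C * ∑ b ∈ Finset.range (k + 1), ‖iteratedFDeriv ℝ b v (F x)‖) v (F x) := by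
  obtain ⟨C1, hC1, H1⟩ := germ (max 1 CF) c₁ (le_max_left _ _) hc₁ k
  obtain ⟨C2, hC2, H2⟩ := germ (max 1 CF) c₁ (le_max_left _ _) hc₁ ℓ
  refine ⟨C2 * C1, by positivity, ?_⟩
  intro c₂ h hh F hFp hFb vhat hvp v hv
  obtain ⟨hF, hF0⟩ := poly_facts hFp
  obtain ⟨hvh, hvh0⟩ := poly_facts hvp
  have hh0 : 0 < h := hh.1
  have hhne : h ≠ 0 := hh0.ne'
  obtain ⟨-, hFm, -, hFd⟩ := hFb
  set G : V → V := fun z => F (h⁻¹ • z) with hGdef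
  set vt : V → V := fun z => h⁻¹ • vhat (h⁻¹ • z) with hvtdef
  have hG : ContDiff ℝ ω G := hF.comp (contDiff_const_smul _)
  have hvs : ContDiff ℝ ω (fun z => vhat (h⁻¹ • z)) := hvh.comp (contDiff_const_smul _)
  have hvt : ContDiff ℝ ω vt := hvs.const_smul _
  have hvt0 : ∀ i, k < i → ∀ z, iteratedFDeriv ℝ i vt z = 0 := by
    intro i hi z
    rw [hvtdef, iteratedFDeriv_const_smul_apply' (hvs.contDiffAt.of_le le_top),
      iteratedFDeriv_comp_const_smul _ (hvh.of_le le_top)]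
    simp [hvh0 i hi]
  have hup : ∀ N z, JB k N vt z → JB ℓ N vt z := by
    intro N z hN i _
    by_cases hi : i ≤ k
    · exact hN i hi
    · rw [hvt0 i (by omega) z, norm_zero]
      exact hN.nonneg
  obtain ⟨B, -, hB⟩ := JB_of_compact (isCompact_closedBall (0 : V) 1)
    (fun x _ => hvt.contDiffAt (x := x)) k
  refine ⟨C2 * B, ?_⟩
  intro x hx
  have hxz : h⁻¹ • (h • x) = x := by rw [smul_smul, inv_mul_cancel₀ hhne, one_smul]
  have hGx : G (h • x) = F x := by rw [hGdef]; simp only [hxz]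
  have hGM : ∀ i, 1 ≤ i → ‖iteratedFDeriv ℝ i G (h • x)‖ ≤ max 1 CF := by
    intro i _
    rw [hGdef, iteratedFDeriv_comp_const_smul _ (hF.of_le le_top)]
    simp only [hxz]
    by_cases hi : i ≤ k
    · rw [norm_smul, norm_pow, norm_inv, Real.norm_of_nonneg hh0.le]
      calc h⁻¹ ^ i * ‖iteratedFDeriv ℝ i F x‖ ≤ h⁻¹ ^ i * (CF * h ^ i) := by
            gcongr
            exact hFm i hi x hx
        _ = CF := by rw [inv_pow]; field_simp
        _ ≤ _ := le_max_right _ _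
    · rw [hF0 i (by omega)]
      simp
  have hdet : dt (fderiv ℝ F x) = jacDet F x := rfl
  have hxc : x ∈ closure Tref := subset_closure hx
  have hGd : c₁ ≤ dt (fderiv ℝ G (h • x)) := by
    rw [scaled_fderiv hF, hxz, dt_smul, hdet]
    have := (hFd x hxc).1
    rw [inv_pow, inv_mul_eq_div, le_div_iff₀ (by positivity)]
    exact this
  have hev : ∀ᶠ z' in 𝓝 (h • x), v (G z') = phiA (fderiv ℝ G z') (vt z') := by
    have h1 : ∀ᶠ z' in 𝓝 (h • x), h⁻¹ • z' ∈ Tref := by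
      have hc : ContinuousAt (fun z' : V => h⁻¹ • z') (h • x) := by fun_prop
      apply hc.eventually (p := fun y => y ∈ Tref)
      simp only [hxz]
      exact Tref_open.mem_nhds hx
    filter_upwards [h1] with z' hz'
    have h2 := hv _ (subset_closure hz')
    change v (F (h⁻¹ • z')) = _
    rw [h2, scaled_fderiv hF]
    have hne : jacDet F (h⁻¹ • z') ≠ 0 := by
      have := (hFd _ (subset_closure hz')).1
      have h3 : 0 < c₁ * h ^ 2 := by positivity
      exact (h3.trans_le this).ne'
    simp only [phiA, dt_smul, hvtdef, Amap]
    have hdet' : dt (fderiv ℝ F (h⁻¹ • z')) = jacDet F (h⁻¹ • z') := rfl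
    rw [hdet', smul_smul]
    simp only [ContinuousLinearMap.smul_apply, map_smul, smul_smul]
    congr 1
    field_simp
  obtain ⟨hcd, a1, -⟩ := H1 G (h • x) hG hGM hGd vt hvt v hev
  obtain ⟨-, -, b2⟩ := H2 G (h • x) hG hGM hGd vt hvt v hev
  rw [hGx] at hcd a1 b2
  have hFne : dt (fderiv ℝ F x) ≠ 0 := by
    have h3 : 0 < c₁ * h ^ 2 := by positivity
    exact (h3.trans_le (hFd x hxc).1).ne'
  refine ⟨(exists_inv hF hFne).1, hcd, ?_, ?_⟩
  · apply b2
    apply hup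
    apply hB
    rw [mem_closedBall_zero_iff, norm_smul, Real.norm_of_nonneg hh0.le]
    have hn : ‖x‖ ≤ 1 := by
      obtain ⟨x1, x2, x3⟩ := hx
      rw [Prod.norm_def, Real.norm_of_nonneg x1.le, Real.norm_of_nonneg x2.le]
      exact max_le (by linarith) (by linarith)
    exact mul_le_one₀ hh.2 (norm_nonneg _) hn
  · rw [mul_assoc]
    apply b2
    apply hup
    apply a1
    intro i hi
    exact Finset.single_le_sum (f := fun b => ‖iteratedFDeriv ℝ b v (F x)‖)
      (fun _ _ => norm_nonneg _) (Finset.mem_range.2 (Nat.lt_succ_of_le hi))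

lemma Lp_lemma {p : ℝ} (hp : 1 ≤ p) (k : ℕ) {C : ℝ} (hC : 0 < C) {S : Set V}
    (hS : MeasurableSet S) (f : V → ℝ) (a : ℕ → V → ℝ) (hf : ∀ y ∈ S, 0 ≤ f y)
    (ha : ∀ b y, 0 ≤ a b y)
    (hle : ∀ y ∈ S, f y ≤ C * ∑ b ∈ Finset.range (k + 1), a b y)
    (hi : ∀ b ∈ Finset.range (k + 1), IntegrableOn (fun y => a b y ^ p) S) :
    (∫ y in S, f y ^ p) ^ (1 / p) ≤
      C * (k + 1) * ∑ b ∈ Finset.range (k + 1), (∫ y in S, a b y ^ p) ^ (1 / p) := by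
  have hp0 : 0 < p := by linarith
  set R := ∑ b ∈ Finset.range (k + 1), (∫ y in S, a b y ^ p) ^ (1 / p) with hR
  have hI0 : ∀ b, 0 ≤ ∫ y in S, a b y ^ p := fun b =>
    integral_nonneg fun y => Real.rpow_nonneg (ha b y) p
  have hR0 : 0 ≤ R := Finset.sum_nonneg fun b _ => Real.rpow_nonneg (hI0 b) _
  have hk0 : (0 : ℝ) < k + 1 := by positivity
  have hIb : ∀ b ∈ Finset.range (k + 1), ∫ y in S, a b y ^ p ≤ R ^ p := by
    intro b hb
    have h1 : (∫ y in S, a b y ^ p) ^ (1 / p) ≤ R :=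
      Finset.single_le_sum (f := fun b => (∫ y in S, a b y ^ p) ^ (1 / p))
        (fun b _ => Real.rpow_nonneg (hI0 b) _) hb
    have h2 := Real.rpow_le_rpow (Real.rpow_nonneg (hI0 b) _) h1 hp0.le
    rwa [← Real.rpow_mul (hI0 b), one_div_mul_cancel hp0.ne', Real.rpow_one] at h2
  have hmain : ∫ y in S, f y ^ p ≤
      ∫ y in S, C ^ p * ((k + 1 : ℝ) ^ (p - 1) * ∑ b ∈ Finset.range (k + 1), a b y ^ p) := by
    apply integral_mono_of_nonneg
    · filter_upwards [ae_restrict_mem hS] with y hy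
      exact Real.rpow_nonneg (hf y hy) p
    · exact ((integrable_finsetSum _ hi).const_mul _).const_mul _
    · filter_upwards [ae_restrict_mem hS] with y hy
      have h1 := Real.rpow_le_rpow (hf y hy) (hle y hy) hp0.le
      have h3 := Real.rpow_sum_le_const_mul_sum_rpow_of_nonneg (Finset.range (k + 1))
        (f := fun b => a b y) hp (fun b _ => ha b y)
      rw [Real.mul_rpow hC.le (Finset.sum_nonneg fun b _ => ha b y)] at h1
      simp only [Finset.card_range] at h3
      push_cast at h3
      exact h1.trans (by gcongr)
  rw [integral_const_mul, integral_const_mul, integral_finsetSum _ hi] at hmain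
  have hsum : ∑ b ∈ Finset.range (k + 1), ∫ y in S, a b y ^ p ≤ (k + 1) * R ^ p := by
    have := Finset.sum_le_card_nsmul _ _ _ hIb
    simpa using this
  have hfin : ∫ y in S, f y ^ p ≤ (C * (k + 1) * R) ^ p := by
    rw [Real.mul_rpow (by positivity) hR0, Real.mul_rpow hC.le hk0.le]
    calc _ ≤ _ := hmain
      _ ≤ C ^ p * ((k + 1 : ℝ) ^ (p - 1) * ((k + 1) * R ^ p)) := by gcongr
      _ = C ^ p * ((k + 1 : ℝ) ^ (p - 1) * (k + 1)) * R ^ p := by ring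
      _ = _ := by
        rw [← Real.rpow_add_one hk0.ne']
        ring_nf
  have h0 : 0 ≤ ∫ y in S, f y ^ p := setIntegral_nonneg hS fun y hy => Real.rpow_nonneg (hf y hy) p
  have := Real.rpow_le_rpow h0 hfin (by positivity : 0 ≤ 1 / p)
  rwa [← Real.rpow_mul (by positivity), mul_one_div_cancel hp0.ne', Real.rpow_one] at this

/-- High-order norms of Piola-transformed piecewise polynomials are controlled by the
`k`-th order norm: `‖v‖_{W^{ℓ,p}(F(K̂ᵢ))} ≤ C ‖v‖_{W^{k,p}(F(K̂ᵢ))}` for `ℓ ≥ k`. -/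
theorem stmt5 (k ℓ : ℕ) (hk : 2 ≤ k) (hℓ : k ≤ ℓ) (p : ℝ) (hp : 1 ≤ p)
    (CF c₁ c₂ : ℝ) (hCF : 0 < CF) (hc₁ : 0 < c₁) (hc₂ : 0 < c₂) :
    ∃ C : ℝ, 0 < C ∧ ∀ h : ℝ, h ∈ Set.Ioc (0 : ℝ) 1 → ∀ F : ℝ × ℝ → ℝ × ℝ,
      IsPolyMap k F → IsoparamBounds k CF c₁ c₂ h F →
      ∀ vhat : ℝ × ℝ → ℝ × ℝ, IsPolyMap k vhat →
      ∀ v : ℝ × ℝ → ℝ × ℝ, IsPiola F vhat v →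
      ∀ i : Fin 3,
        normWmp ℓ p v (F '' ctK i) ≤ C * normWmp k p v (F '' ctK i) := by
  obtain ⟨C, hC, H⟩ := point k ℓ hℓ CF c₁ hc₁
  refine ⟨(ℓ + 1) * (C * (k + 1)), by positivity, ?_⟩
  intro h hh F hFp hFb vhat hvp v hv i
  obtain ⟨B, hB⟩ := H c₂ h hh F hFp hFb vhat hvp v hv
  have hsub := ctK_sub i
  have hSo : IsOpen (F '' ctK i) := by
    rw [isOpen_iff_mem_nhds]
    rintro _ ⟨x, hx, rfl⟩
    apply (hB x (hsub hx)).1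
    exact Filter.image_mem_map (isOpen_interior.mem_nhds hx)
  have hSm := hSo.measurableSet
  have hfin : volume (F '' ctK i) ≠ ⊤ := by
    have hb : F '' ctK i ⊆ Metric.closedBall 0 CF := by
      rintro _ ⟨x, hx, rfl⟩
      have := hFb.2.1 0 (Nat.zero_le _) x (hsub hx)
      simpa using this
    exact ((measure_mono hb).trans_lt measure_closedBall_lt_top).ne
  have hp0 : 0 ≤ p := by linarith
  have hInteg : ∀ b ∈ Finset.range (k + 1),
      IntegrableOn (fun y => ‖iteratedFDeriv ℝ b v y‖ ^ p) (F '' ctK i) := by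
    intro b hb
    have hbℓ : b ≤ ℓ := by
      have := Finset.mem_range.1 hb
      omega
    have hcont : ContinuousOn (fun y => ‖iteratedFDeriv ℝ b v y‖ ^ p) (F '' ctK i) := by
      rintro _ ⟨x, hx, rfl⟩
      have h1 := (hB x (hsub hx)).2.1.continuousAt_iteratedFDeriv (k := b) le_top
      exact (h1.norm.rpow_const (Or.inr hp0)).continuousWithinAt
    refine ⟨hcont.aestronglyMeasurable hSm, ?_⟩
    refine HasFiniteIntegral.restrict_of_bounded (C := B ^ p) hfin.lt_top ?_
    filter_upwards [ae_restrict_mem hSm] with y hy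
    obtain ⟨x, hx, rfl⟩ := hy
    have h2 := (hB x (hsub hx)).2.2.1 b hbℓ
    rw [Real.norm_of_nonneg (by positivity)]
    exact Real.rpow_le_rpow (norm_nonneg _) h2 hp0
  have hj : ∀ j ∈ Finset.range (ℓ + 1),
      semiLp j p v (F '' ctK i) ≤ C * (k + 1) * normWmp k p v (F '' ctK i) := by
    intro j hj
    refine Lp_lemma hp k hC hSm _ (fun b y => ‖iteratedFDeriv ℝ b v y‖)
      (fun y _ => norm_nonneg _) (fun _ _ => norm_nonneg _) ?_ hInteg
    rintro _ ⟨x, hx, rfl⟩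
    exact (hB x (hsub hx)).2.2.2 j (Nat.lt_succ_iff.1 (Finset.mem_range.1 hj))
  have := Finset.sum_le_card_nsmul _ _ _ hj
  rw [Finset.card_range, nsmul_eq_mul] at this
  rw [mul_assoc]
  calc normWmp ℓ p v (F '' ctK i) ≤ _ := this
    _ = _ := by push_cast; ring
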